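/- arXiv:1905.05067 — 7 statements merged into one kernel-verified Lean document; each statement's English description precedes it below -/
import Mathlib

section
/- Let R be a commutative ring, n ∈ ℕ, T an n×n matrix over R, and J ⊆ Fin n with complement K = Jᶜ. Assume T = 1 + C where every column of C with index outside J is zero (i.e. C i k = 0 for all i and all k ∈ K), and assume T is invertible. Then the submatrix T_{J,J} is invertible, and moreover: (T⁻¹)_{J,J} = (T_{J,J})⁻¹; (T⁻¹)_{K,J} = −T_{K,J} · (T_{J,J})⁻¹; (T⁻¹)_{K,K} is the identity matrix; and (T⁻¹)_{J,K} = 0. -/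
open Matrix

/-- Block multiplication along a partition of the summation index into a set and its complement. -/
theorem Matrix.submatrix_mul_eq_add_compl {R l m o l' o' : Type*} [NonUnitalNonAssocSemiring R]
    [Fintype m] (A : Matrix l m R) (B : Matrix m o R) (J : Set m) [Fintype J]
    [Fintype (Jᶜ : Set m)] (f : l' → l) (g : o' → o) :
    (A * B).submatrix f g =
      A.submatrix f (fun j : J => (j : m)) * B.submatrix (fun j : J => (j : m)) g +
      A.submatrix f (fun j : (Jᶜ : Set m) => (j : m)) *
        B.submatrix (fun j : (Jᶜ : Set m) => (j : m)) g := by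
  classical
  ext a b
  simp only [submatrix_apply, add_apply, mul_apply]
  rw [← (Equiv.Set.sumCompl J).sum_comp, Fintype.sum_sum_type]
  simp only [Equiv.Set.sumCompl_apply_inl, Equiv.Set.sumCompl_apply_inr]

/-- If some columns of an invertible matrix agree with those of the identity, then so do the same
columns of its inverse. -/
theorem Matrix.inv_apply_eq_one_of_col_eq_one {R m : Type*} [CommRing R] [Fintype m]
    [DecidableEq m] {T : Matrix m m R} (hinv : IsUnit T.det) {k : m}
    (hk : ∀ i, T i k = (1 : Matrix m m R) i k) (i : m) :
    T⁻¹ i k = (1 : Matrix m m R) i k := by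
  have h := congrFun (congrFun (nonsing_inv_mul T hinv) i) k
  simpa [mul_apply, hk, one_apply] using h

theorem stmt_1 {R : Type*} [CommRing R] {n : ℕ}
    (T C : Matrix (Fin n) (Fin n) R) (J : Set (Fin n)) [DecidablePred (· ∈ J)]
    (hT : T = 1 + C)
    (hC : ∀ i k : Fin n, k ∈ Jᶜ → C i k = 0)
    (hinv : IsUnit T.det) :
    IsUnit (T.submatrix (fun i : J => (i : Fin n)) (fun j : J => (j : Fin n))).det ∧
    (T⁻¹).submatrix (fun i : J => (i : Fin n)) (fun j : J => (j : Fin n)) =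
      (T.submatrix (fun i : J => (i : Fin n)) (fun j : J => (j : Fin n)))⁻¹ ∧
    (T⁻¹).submatrix (fun i : (Jᶜ : Set (Fin n)) => (i : Fin n)) (fun j : J => (j : Fin n)) =
      -(T.submatrix (fun i : (Jᶜ : Set (Fin n)) => (i : Fin n)) (fun j : J => (j : Fin n)) *
        (T.submatrix (fun i : J => (i : Fin n)) (fun j : J => (j : Fin n)))⁻¹) ∧
    (T⁻¹).submatrix (fun i : (Jᶜ : Set (Fin n)) => (i : Fin n))
        (fun j : (Jᶜ : Set (Fin n)) => (j : Fin n)) = 1 ∧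
    (T⁻¹).submatrix (fun i : J => (i : Fin n)) (fun j : (Jᶜ : Set (Fin n)) => (j : Fin n)) = 0 := by
  have hcol : ∀ k ∈ Jᶜ, ∀ i, T⁻¹ i k = (1 : Matrix (Fin n) (Fin n) R) i k := fun k hk =>
    inv_apply_eq_one_of_col_eq_one hinv fun i => by simp [hT, hC i k hk]
  have hKK : (T⁻¹).submatrix (fun i : (Jᶜ : Set (Fin n)) => (i : Fin n))
      (fun j : (Jᶜ : Set (Fin n)) => (j : Fin n)) = 1 := by
    ext i j
    simp [hcol j j.2, one_apply, Subtype.ext_iff]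
  have hJK : (T⁻¹).submatrix (fun i : J => (i : Fin n))
      (fun j : (Jᶜ : Set (Fin n)) => (j : Fin n)) = 0 := by
    ext i j
    have hij : (i : Fin n) ≠ j := fun h => j.2 (h ▸ i.2)
    simp [hcol j j.2, one_apply, hij]
  have hJJ := submatrix_mul_eq_add_compl T⁻¹ T J
    (fun i : J => (i : Fin n)) (fun j : J => (j : Fin n))
  have hKJ := submatrix_mul_eq_add_compl T⁻¹ T J
    (fun i : (Jᶜ : Set (Fin n)) => (i : Fin n)) (fun j : J => (j : Fin n))
  rw [nonsing_inv_mul T hinv, hJK, Matrix.zero_mul, add_zero,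
    submatrix_one _ Subtype.val_injective] at hJJ
  have hone : (1 : Matrix (Fin n) (Fin n) R).submatrix
      (fun i : (Jᶜ : Set (Fin n)) => (i : Fin n)) (fun j : J => (j : Fin n)) = 0 := by
    ext i j
    have hij : (i : Fin n) ≠ j := fun h => i.2 (h ▸ j.2)
    simp [one_apply, hij]
  rw [nonsing_inv_mul T hinv, hKK, Matrix.one_mul, hone] at hKJ
  have hdet := isUnit_det_of_left_inverse hJJ.symm
  refine ⟨hdet, (inv_eq_left_inv hJJ.symm).symm, ?_, hKK, hJK⟩
  rw [← Matrix.neg_mul, ← eq_neg_of_add_eq_zero_left hKJ.symm,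
    mul_nonsing_inv_cancel_right _ _ hdet]
end

section
/- Adjugate form of the matrix determinant lemma: let A be any n×n matrix over a commutative ring and let u, v be vectors of length n. Then det(A + u vᵀ) = det(A) + v ⬝ (adjugate(A) u), where u vᵀ denotes the outer product matrix (vecMulVec u v), adjugate(A) is the classical adjoint of A, and v ⬝ (adjugate(A) u) is the inner product of v with the matrix-vector product adjugate(A) · u. -/
open Matrix

theorem Matrix.det_mul_det_add_vecMulVec {m R : Type*} [Fintype m] [DecidableEq m] [CommRing R]
    (A : Matrix m m R) (u v : m → R) :
    (A + vecMulVec u v).det * A.det = A.det * (A.det + v ⬝ᵥ A.adjugate *ᵥ u) := by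
  have hblock : fromBlocks A (replicateCol Unit u) (-replicateRow Unit v) 1 *
      fromBlocks 1 (-replicateCol Unit (A.adjugate *ᵥ u)) 0 (A.det • (1 : Matrix Unit Unit R)) =
      fromBlocks A 0 (-replicateRow Unit v)
        ((A.det + v ⬝ᵥ A.adjugate *ᵥ u) • (1 : Matrix Unit Unit R)) := by
    rw [fromBlocks_multiply]
    congr 1
    · simp
    · rw [Matrix.mul_neg, ← replicateCol_mulVec, mulVec_mulVec, mul_adjugate, smul_mulVec,
        one_mulVec]
      ext i j
      simp
    · simp
    · ext i j
      simp [Matrix.mul_apply, dotProduct, add_comm]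
  have hdet := congrArg det hblock
  rw [det_mul, det_fromBlocks_one₂₂, det_fromBlocks_zero₂₁, det_fromBlocks_zero₁₂] at hdet
  simpa [vecMulVec_eq Unit] using hdet

theorem Matrix.det_add_vecMulVec_eq_det_add_adjugate {m R : Type*} [Fintype m] [DecidableEq m]
    [CommRing R] (A : Matrix m m R) (u v : m → R) :
    (A + vecMulVec u v).det = A.det + v ⬝ᵥ A.adjugate *ᵥ u := by
  let B := charmatrix (-A)
  let f := Polynomial.evalRingHom (0 : R)
  have hB : f.mapMatrix B = A := by
    ext i j
    by_cases h : i = j <;> simp [B, f, h]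
  have hreg : IsLeftRegular B.det := (charpoly_monic (-A)).isRegular.left
  have hpoly : (B + vecMulVec (Polynomial.C ∘ u) (Polynomial.C ∘ v)).det =
      B.det + (Polynomial.C ∘ v) ⬝ᵥ B.adjugate *ᵥ (Polynomial.C ∘ u) := by
    apply hreg
    simpa only [mul_comm] using det_mul_det_add_vecMulVec B (Polynomial.C ∘ u) (Polynomial.C ∘ v)
  have hC (w : m → R) : f ∘ Polynomial.C ∘ w = w := by
    ext i
    simp [f]
  have hvec : f.mapMatrix (vecMulVec (Polynomial.C ∘ u) (Polynomial.C ∘ v)) = vecMulVec u v := by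
    ext i j
    simp [f, vecMulVec_apply]
  have hmulVec : f ∘ (B.adjugate *ᵥ (Polynomial.C ∘ u)) = A.adjugate *ᵥ u := by
    ext i
    rw [Function.comp_apply, RingHom.map_mulVec, hC, ← RingHom.mapMatrix_apply,
      RingHom.map_adjugate, hB]
  simpa only [map_add, RingHom.map_det, RingHom.map_dotProduct, hB, hvec, hC, hmulVec] using
    congrArg f hpoly

theorem stmt_5 {R : Type*} [CommRing R] {n : ℕ} (A : Matrix (Fin n) (Fin n) R)
    (u v : Fin n → R) :
    (A + Matrix.vecMulVec u v).det = A.det + v ⬝ᵥ A.adjugate.mulVec u :=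
  det_add_vecMulVec_eq_det_add_adjugate A u v
end

section
/- Let R be a commutative ring, s, n ∈ ℕ, and A : Fin s → (n×n matrices over R) a sequence of matrices A₁, …, A_s. Define the (s+1)n × (s+1)n block matrix M, indexed by pairs (i, a) with i ∈ Fin (s+1) and a ∈ Fin n, by: the diagonal blocks M(i, i) are the identity, the superdiagonal blocks M(i, i+1) equal A_{i+1}, and all other blocks are zero. Then M is invertible and its inverse N is the block matrix given by N(i, j) = (−1)^{j−i} · (A_{i+1} · A_{i+2} · ⋯ · A_j) for i ≤ j (with the empty product for i = j being the identity) and N(i, j) = 0 for i > j. In particular, the top-right block of M⁻¹ equals (−1)^s · A₁A₂⋯A_s. -/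
open Matrix

/-- The `(s+1)n × (s+1)n` block matrix with identity diagonal blocks, the matrices
`A 0, …, A (s-1)` on the superdiagonal blocks, and zero blocks elsewhere. -/
def blockChainMatrix {R : Type*} [CommRing R] {s n : ℕ}
    (A : Fin s → Matrix (Fin n) (Fin n) R) :
    Matrix (Fin (s + 1) × Fin n) (Fin (s + 1) × Fin n) R :=
  fun p q =>
    if p.1 = q.1 then (if p.2 = q.2 then 1 else 0)
    else if h : (q.1 : ℕ) = (p.1 : ℕ) + 1 then
      A ⟨(p.1 : ℕ), by have := q.1.isLt; omega⟩ p.2 q.2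
    else 0

/-- The ordered product `A i * A (i+1) * ⋯ * A (j-1)` of the consecutive matrices with
indices `t` satisfying `i ≤ t < j` (the identity matrix if there are no such indices). -/
def consecProd {R : Type*} [CommRing R] {s n : ℕ}
    (A : Fin s → Matrix (Fin n) (Fin n) R) (i j : ℕ) : Matrix (Fin n) (Fin n) R :=
  (((List.finRange s).filter (fun t : Fin s => decide (i ≤ (t : ℕ) ∧ (t : ℕ) < j))).map A).prod

theorem consecProd_eq_one_of_le {R : Type*} [CommRing R] {s n : ℕ}
    (A : Fin s → Matrix (Fin n) (Fin n) R) {i j : ℕ} (h : j ≤ i) :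
    consecProd A i j = 1 := by
  have hnil : (List.finRange s).filter
      (fun t : Fin s => decide (i ≤ (t : ℕ) ∧ (t : ℕ) < j)) = [] := by
    rw [List.filter_eq_nil_iff]
    intro t _
    simp only [decide_eq_true_eq]
    omega
  rw [consecProd, hnil, List.map_nil, List.prod_nil]

theorem consecProd_eq_mul {R : Type*} [CommRing R] {s n : ℕ}
    (A : Fin s → Matrix (Fin n) (Fin n) R) {i j : ℕ} (hi : i < s) (hij : i < j) :
    consecProd A i j = A ⟨i, hi⟩ * consecProd A (i + 1) j := by
  have hcons : (List.finRange s).filter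
        (fun t : Fin s => decide (i ≤ (t : ℕ) ∧ (t : ℕ) < j)) =
      ⟨i, hi⟩ :: (List.finRange s).filter
        (fun t : Fin s => decide (i + 1 ≤ (t : ℕ) ∧ (t : ℕ) < j)) := by
    refine List.SortedLT.eq_of_mem_iff
      ((List.pairwise_lt_finRange s).filter _).sortedLT
      (List.Pairwise.sortedLT
        (List.pairwise_cons.2 ⟨?_, (List.pairwise_lt_finRange s).filter _⟩)) ?_
    · intro t ht
      simp only [List.mem_filter, decide_eq_true_eq] at ht
      rw [Fin.lt_def]
      exact ht.2.1
    · intro t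
      simp only [List.mem_filter, List.mem_finRange, List.mem_cons, decide_eq_true_eq,
        Fin.ext_iff, true_and]
      omega
  simp only [consecProd, hcons, List.map_cons, List.prod_cons]

theorem sum_blockChainMatrix_mul {R : Type*} [CommRing R] {s n : ℕ}
    (A : Fin s → Matrix (Fin n) (Fin n) R) (v : Fin (s + 1) × Fin n → R)
    (i : Fin (s + 1)) (a : Fin n) :
    ∑ p, blockChainMatrix A (i, a) p * v p =
      v (i, a) + if h : (i : ℕ) < s then
        ∑ c, A ⟨i, h⟩ a c * v (⟨i + 1, Nat.succ_lt_succ h⟩, c) else 0 := by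
  have hdiag (c : Fin n) : blockChainMatrix A (i, a) (i, c) = if a = c then 1 else 0 := by
    simp [blockChainMatrix]
  rw [Fintype.sum_prod_type]
  split_ifs with h
  · rw [Fintype.sum_eq_add i ⟨i + 1, Nat.succ_lt_succ h⟩]
    · congr 1
      · simp [hdiag]
      · simp [blockChainMatrix, Fin.ext_iff]
    · simp [Fin.ext_iff]
    · rintro k ⟨hk, hk'⟩
      refine Finset.sum_eq_zero fun c _ => ?_
      have hk'' : (k : ℕ) ≠ i + 1 := fun e => hk' (Fin.ext e)
      simp [blockChainMatrix, hk.symm, hk'']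
  · rw [Fintype.sum_eq_single i]
    · simp [hdiag]
    · intro k hk
      refine Finset.sum_eq_zero fun c _ => ?_
      have hk' : (k : ℕ) ≠ i + 1 := by omega
      simp [blockChainMatrix, hk.symm, hk']

/-- The explicit inverse of `blockChainMatrix A`. -/
def blockChainInverse {R : Type*} [CommRing R] {s n : ℕ}
    (A : Fin s → Matrix (Fin n) (Fin n) R) :
    Matrix (Fin (s + 1) × Fin n) (Fin (s + 1) × Fin n) R :=
  fun p q =>
    if (p.1 : ℕ) ≤ (q.1 : ℕ) then
      ((-1 : R) ^ ((q.1 : ℕ) - (p.1 : ℕ))) * consecProd A (p.1 : ℕ) (q.1 : ℕ) p.2 q.2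
    else 0

theorem blockChainMatrix_mul_blockChainInverse {R : Type*} [CommRing R] {s n : ℕ}
    (A : Fin s → Matrix (Fin n) (Fin n) R) :
    blockChainMatrix A * blockChainInverse A = 1 := by
  ext ⟨i, a⟩ ⟨j, b⟩
  rw [Matrix.mul_apply, sum_blockChainMatrix_mul A fun p => blockChainInverse A p (j, b)]
  simp only [blockChainInverse]
  rcases lt_trichotomy (i : ℕ) (j : ℕ) with hij | hij | hij
  · have hi : (i : ℕ) < s := by omega
    have hne : i ≠ j := fun e => hij.ne (congrArg Fin.val e)
    have hexp : (j : ℕ) - i = (j - (i + 1)) + 1 := by omega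
    simp only [hi, hij.le, Nat.succ_le_of_lt hij, if_true, dif_pos, Matrix.one_apply,
      Prod.mk.injEq, hne, false_and, if_false]
    rw [consecProd_eq_mul A hi hij, Matrix.mul_apply, hexp, pow_succ, Finset.mul_sum,
      ← Finset.sum_add_distrib]
    exact Finset.sum_eq_zero fun c _ => by ring
  · obtain rfl : i = j := Fin.ext hij
    simp [consecProd_eq_one_of_le, Matrix.one_apply]
  · have hne : i ≠ j := fun e => hij.ne' (congrArg Fin.val e)
    have h1 : ¬ (i : ℕ) + 1 ≤ j := by omega
    simp [hij.not_ge, h1, hne]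

theorem stmt_7 {R : Type*} [CommRing R] {s n : ℕ}
    (A : Fin s → Matrix (Fin n) (Fin n) R) :
    IsUnit (blockChainMatrix A).det ∧
    (∀ (i j : Fin (s + 1)) (a b : Fin n),
      (blockChainMatrix A)⁻¹ (i, a) (j, b) =
        if (i : ℕ) ≤ (j : ℕ) then
          ((-1 : R) ^ ((j : ℕ) - (i : ℕ))) * consecProd A (i : ℕ) (j : ℕ) a b
        else 0) ∧
    (∀ a b : Fin n,
      (blockChainMatrix A)⁻¹ ((0 : Fin (s + 1)), a) (Fin.last s, b) =
        ((-1 : R) ^ s) * consecProd A 0 s a b) := by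
  have hmul := blockChainMatrix_mul_blockChainInverse A
  rw [Matrix.inv_eq_right_inv hmul]
  refine ⟨Matrix.isUnit_det_of_right_inverse hmul, fun _ _ _ _ => rfl, fun a b => ?_⟩
  simp [blockChainInverse]
end

section
/- Let A be an m×n matrix over a commutative ring such that the n×n matrix AᵀA is invertible. Then the (m+n)×(m+n) block matrix fromBlocks 1 A Aᵀ 0 (i.e. [[I, A], [Aᵀ, 0]]) is invertible and its inverse equals fromBlocks (1 − A(AᵀA)⁻¹Aᵀ) (A(AᵀA)⁻¹) ((AᵀA)⁻¹Aᵀ) (−(AᵀA)⁻¹). In particular, the lower-left block of the inverse is the pseudo-inverse (AᵀA)⁻¹Aᵀ of A. -/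
open Matrix

theorem stmt_9 {R : Type*} [CommRing R] {m n : Type*} [Fintype m] [Fintype n]
    [DecidableEq m] [DecidableEq n]
    (A : Matrix m n R) (h : IsUnit (Aᵀ * A).det) :
    IsUnit (Matrix.fromBlocks (1 : Matrix m m R) A Aᵀ (0 : Matrix n n R)).det ∧
      (Matrix.fromBlocks (1 : Matrix m m R) A Aᵀ (0 : Matrix n n R))⁻¹ =
        Matrix.fromBlocks (1 - A * (Aᵀ * A)⁻¹ * Aᵀ) (A * (Aᵀ * A)⁻¹)
          ((Aᵀ * A)⁻¹ * Aᵀ) (-(Aᵀ * A)⁻¹) := by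
  have hG : Aᵀ * (A * (Aᵀ * A)⁻¹) = 1 := by
    rw [← Matrix.mul_assoc, Matrix.mul_nonsing_inv _ h]
  have hMN : Matrix.fromBlocks (1 : Matrix m m R) A Aᵀ (0 : Matrix n n R) *
      Matrix.fromBlocks (1 - A * (Aᵀ * A)⁻¹ * Aᵀ) (A * (Aᵀ * A)⁻¹)
        ((Aᵀ * A)⁻¹ * Aᵀ) (-(Aᵀ * A)⁻¹) = 1 := by
    have hlower : Aᵀ * (1 - A * (Aᵀ * A)⁻¹ * Aᵀ) = 0 := by
      rw [Matrix.mul_sub, ← Matrix.mul_assoc Aᵀ (A * _), hG, Matrix.mul_one, Matrix.one_mul,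
        sub_self]
    rw [Matrix.fromBlocks_multiply, hlower, hG, ← Matrix.mul_assoc A]
    simp
  exact ⟨Matrix.isUnit_det_of_right_inverse hMN, Matrix.inv_eq_right_inv hMN⟩
end

section
/- Edmonds' theorem for the symbolic bipartite matching matrix: let n ∈ ℕ and E ⊆ Fin n × Fin n a finite set of edges of a bipartite graph with left vertex set Fin n and right vertex set Fin n. Let K be the field of fractions of the multivariate polynomial ring ℚ[X_{(i,j)} : (i,j) ∈ Fin n × Fin n], and let M be the n×n matrix over K with M i j = X_{(i,j)} if (i,j) ∈ E and M i j = 0 otherwise. Then the rank of M equals the maximum cardinality of a matching of the bipartite graph, i.e. the maximum of |S| over all subsets S ⊆ E such that the first-coordinate projection is injective on S and the second-coordinate projection is injective on S. -/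
open Matrix

namespace Matrix

theorem exists_linearIndependent_row_comp {m n F : Type*} [Fintype m] [Fintype n] [Field F]
    (A : Matrix m n F) : ∃ f : Fin A.rank → m, LinearIndependent F (A.row ∘ f) := by
  rw [A.rank_eq_finrank_span_row]
  obtain ⟨g, hg, -, hli⟩ := Submodule.exists_fun_fin_finrank_span_eq F (Set.range A.row)
  choose f hf using hg
  exact ⟨f, by rwa [show A.row ∘ f = g from funext hf]⟩

theorem exists_submatrix_det_ne_zero {m n F : Type*} [Fintype m] [Fintype n] [Field F]
    (A : Matrix m n F) :
    ∃ (f : Fin A.rank → m) (g : Fin A.rank → n), (A.submatrix f g).det ≠ 0 := by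
  obtain ⟨f, hf⟩ := A.exists_linearIndependent_row_comp
  have hrank : (A.submatrix f id)ᵀ.rank = A.rank := by
    rw [rank_transpose]
    simpa using LinearIndependent.rank_matrix (M := A.submatrix f id) hf
  obtain ⟨g, hg⟩ := (A.submatrix f id)ᵀ.exists_linearIndependent_row_comp
  let c := finCongr hrank.symm
  refine ⟨f, g ∘ c, ?_⟩
  have hcols : LinearIndependent F (A.submatrix f (g ∘ c)).col := hg.comp c c.injective
  rw [linearIndependent_cols_iff_isUnit, isUnit_iff_isUnit_det] at hcols
  exact hcols.ne_zero

/-- The support of a matrix over a field contains a partial matching of size the rank. -/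
theorem exists_matching_card_eq_rank {m n F : Type*} [Fintype m] [Fintype n] [DecidableEq m]
    [DecidableEq n] [Field F] (A : Matrix m n F) :
    ∃ S : Finset (m × n), (∀ e ∈ S, A e.1 e.2 ≠ 0) ∧ Set.InjOn Prod.fst (S : Set (m × n)) ∧
      Set.InjOn Prod.snd (S : Set (m × n)) ∧ S.card = A.rank := by
  obtain ⟨f, g, hdet⟩ := A.exists_submatrix_det_ne_zero
  have hf : Function.Injective f := fun a b hab ↦ by
    by_contra hne
    exact hdet (det_zero_of_row_eq hne (by ext; simp [hab]))
  have hg : Function.Injective g := fun a b hab ↦ by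
    by_contra hne
    exact hdet (det_zero_of_column_eq hne (by simp [hab]))
  rw [det_apply] at hdet
  obtain ⟨σ, -, hσ⟩ := Finset.exists_ne_zero_of_sum_ne_zero hdet
  have hprod : ∀ i, A (f (σ i)) (g i) ≠ 0 := fun i hi ↦
    hσ (by rw [Finset.prod_eq_zero (Finset.mem_univ i) (by simpa using hi), smul_zero])
  refine ⟨Finset.univ.image fun i ↦ (f (σ i), g i), by simpa using hprod, ?_, ?_, ?_⟩
  · rintro _ ha _ hb hab
    simp only [Finset.coe_image, Finset.coe_univ, Set.image_univ, Set.mem_range] at ha hb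
    obtain ⟨i, rfl⟩ := ha
    obtain ⟨j, rfl⟩ := hb
    rw [σ.injective (hf hab)]
  · rintro _ ha _ hb hab
    simp only [Finset.coe_image, Finset.coe_univ, Set.image_univ, Set.mem_range] at ha hb
    obtain ⟨i, rfl⟩ := ha
    obtain ⟨j, rfl⟩ := hb
    rw [hg hab]
  · rw [Finset.card_image_of_injective _ fun i j hij ↦ hg (congrArg Prod.snd hij)]
    simp

/-- A matching in the support pattern of a matrix of indeterminates bounds its rank from below. -/
theorem card_le_rank_of_matching {m n R K : Type*} [Fintype m] [Fintype n] [DecidableEq m]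
    [DecidableEq n] [CommRing R] [Nontrivial R] [Field K] [Algebra (MvPolynomial (m × n) R) K]
    [FaithfulSMul (MvPolynomial (m × n) R) K] {E S : Finset (m × n)} (hSE : S ⊆ E)
    (hfst : Set.InjOn Prod.fst (S : Set (m × n))) (hsnd : Set.InjOn Prod.snd (S : Set (m × n))) :
    S.card ≤ (Matrix.of fun (i : m) (j : n) =>
      if (i, j) ∈ E then algebraMap (MvPolynomial (m × n) R) K (MvPolynomial.X (i, j))
      else 0).rank := by
  set A := Matrix.of fun (i : m) (j : n) =>
    if (i, j) ∈ E then algebraMap (MvPolynomial (m × n) R) K (MvPolynomial.X (i, j)) else 0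
    with hA
  let P : Matrix S S (MvPolynomial (m × n) R) := Matrix.of fun a b =>
    if (a.1.1, b.1.2) ∈ E then MvPolynomial.X (a.1.1, b.1.2) else 0
  have hmap : A.submatrix (fun a : S ↦ a.1.1) (fun b : S ↦ b.1.2) =
      (algebraMap (MvPolynomial (m × n) R) K).mapMatrix P := by
    ext a b
    simp [hA, P, apply_ite (algebraMap (MvPolynomial (m × n) R) K)]
  have heval : (MvPolynomial.eval fun e ↦ if e ∈ S then (1 : R) else 0).mapMatrix P = 1 := by
    ext a b
    obtain rfl | hab := eq_or_ne a b
    · simp [P, hSE a.2]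
    · have hnot : (a.1.1, b.1.2) ∉ S := fun h ↦ hab <| Subtype.ext <|
        (hfst a.2 h rfl).trans (hsnd h b.2 rfl)
      simp [P, hab, apply_ite (MvPolynomial.eval _), hnot]
  have hdet : P.det ≠ 0 := fun h ↦ by
    have := congrArg det heval
    rw [← RingHom.map_det, h] at this
    simp at this
  have hunit : IsUnit (A.submatrix (fun a : S ↦ a.1.1) (fun b : S ↦ b.1.2)) := by
    rw [isUnit_iff_isUnit_det, hmap, ← RingHom.map_det, isUnit_iff_ne_zero]
    simpa using hdet
  have hrank := rank_of_isUnit _ hunit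
  rw [Fintype.card_coe] at hrank
  exact hrank ▸ A.rank_submatrix_le _ _

end Matrix

theorem stmt_14 (n : ℕ) (E : Finset (Fin n × Fin n)) :
    (Matrix.of (fun i j : Fin n =>
        if (i, j) ∈ E then
          algebraMap (MvPolynomial (Fin n × Fin n) ℚ)
            (FractionRing (MvPolynomial (Fin n × Fin n) ℚ)) (MvPolynomial.X (i, j))
        else 0)).rank =
      sSup {k : ℕ | ∃ S : Finset (Fin n × Fin n), S ⊆ E ∧
        Set.InjOn (Prod.fst : Fin n × Fin n → Fin n) ↑S ∧
        Set.InjOn (Prod.snd : Fin n × Fin n → Fin n) ↑S ∧ S.card = k} := by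
  refine (IsGreatest.csSup_eq ⟨?_, ?_⟩).symm
  · obtain ⟨S, hS, hfst, hsnd, hcard⟩ := exists_matching_card_eq_rank (Matrix.of fun i j : Fin n =>
      if (i, j) ∈ E then algebraMap (MvPolynomial (Fin n × Fin n) ℚ)
        (FractionRing (MvPolynomial (Fin n × Fin n) ℚ)) (MvPolynomial.X (i, j)) else 0)
    refine ⟨S, fun e he ↦ ?_, hfst, hsnd, hcard⟩
    by_contra hE
    exact hS e he (by simp [hE])
  · rintro _ ⟨S, hSE, hfst, hsnd, rfl⟩
    exact card_le_rank_of_matching hSE hfst hsnd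
end

section
/- Cycle detection via determinants: let n ∈ ℕ and E ⊆ Fin n × Fin n a finite set of directed edges. Let M be the n×n matrix over the multivariate polynomial ring ℚ[X_{(i,j)} : (i,j) ∈ Fin n × Fin n] with M i j = X_{(i,j)} if (i,j) ∈ E and M i j = 0 otherwise. Then det(1 + M) = 1 if and only if the directed graph (Fin n, E) contains no directed cycle. -/
open Matrix

/-- A directed graph on `Fin n` with edge set `E` has a directed cycle: there is a `k ≥ 1`
and an injective map `v : Fin k → Fin n` such that `(v i, v ((i+1) mod k)) ∈ E` for all `i`
(self-loops are cycles of length 1). -/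
def HasDirectedCycle {n : ℕ} (E : Set (Fin n × Fin n)) : Prop :=
  ∃ (k : ℕ) (hk : 0 < k) (v : Fin k → Fin n), Function.Injective v ∧
    ∀ i : Fin k, (v i, v ⟨((i : ℕ) + 1) % k, Nat.mod_lt _ hk⟩) ∈ E

/-- A permutation whose nontrivial moves are all edges yields a directed cycle through every
point it moves. -/
theorem HasDirectedCycle.of_perm {n : ℕ} {E : Set (Fin n × Fin n)} (τ : Equiv.Perm (Fin n))
    (hτ : ∀ y, τ y ≠ y → (y, τ y) ∈ E) {x : Fin n} (hx : τ x ≠ x) : HasDirectedCycle E := by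
  have hper : x ∈ Function.periodicPts τ :=
    Function.Injective.mem_periodicPts τ.injective x
  refine ⟨Function.minimalPeriod τ x, Function.minimalPeriod_pos_of_mem_periodicPts hper,
    fun i => τ^[i] x, ?_, ?_⟩
  · intro i j hij
    exact Fin.ext (Function.iterate_injOn_Iio_minimalPeriod i.2 j.2 hij)
  · intro i
    have hstep : τ^[((i : ℕ) + 1) % Function.minimalPeriod τ x] x = τ (τ^[i] x) := by
      rw [Function.iterate_mod_minimalPeriod_eq, Function.iterate_succ_apply']
    simp only [hstep]
    refine hτ _ fun hfix => hx ?_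
    rw [← Function.iterate_succ_apply' τ, Function.iterate_succ_apply] at hfix
    exact (τ.injective.iterate i) hfix

/-- If `E` has a directed cycle, some rational weighting `A` supported on `E` makes `1 + A`
singular. -/
theorem HasDirectedCycle.exists_det_eq_zero {n : ℕ} {E : Set (Fin n × Fin n)}
    (h : HasDirectedCycle E) : ∃ w : Fin n × Fin n → ℚ, (∀ e, e ∉ E → w e = 0) ∧
      (1 + Matrix.of fun i j => w (i, j)).det = 0 := by
  classical
  obtain ⟨k, hk, v, hv, hE⟩ := h
  let s : Fin k → Fin k := fun i => ⟨((i : ℕ) + 1) % k, Nat.mod_lt _ hk⟩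
  refine ⟨fun e => if ∃ i, (v i, v (s i)) = e then -1 else 0, ?_, ?_⟩
  · intro e he
    refine if_neg ?_
    rintro ⟨i, rfl⟩
    exact he (hE i)
  · refine Matrix.exists_mulVec_eq_zero_iff.mp
      ⟨fun a => if a ∈ Set.range v then 1 else 0, ?_, ?_⟩
    · intro h0
      have := congrFun h0 (v ⟨0, hk⟩)
      simp at this
    · ext a
      rw [Matrix.add_mulVec, Matrix.one_mulVec, Pi.add_apply, Matrix.mulVec, dotProduct]
      by_cases ha : a ∈ Set.range v
      · obtain ⟨i, rfl⟩ := ha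
        rw [Finset.sum_eq_single (v (s i))]
        · have : ∃ j, (v j, v (s j)) = (v i, v (s i)) := ⟨i, rfl⟩
          simp only [Matrix.of_apply, if_pos this, Set.mem_range_self, if_true]
          simp
        · intro b _ hb
          have : ¬ ∃ j, (v j, v (s j)) = (v i, b) := by
            rintro ⟨j, hj⟩
            obtain ⟨h1, h2⟩ := Prod.mk.inj hj
            rw [hv h1] at h2
            exact hb h2.symm
          simp only [Matrix.of_apply, if_neg this, zero_mul]
        · simp
      · have (b : Fin n) : ¬ ∃ j, (v j, v (s j)) = (a, b) := by
          rintro ⟨j, hj⟩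
          exact ha ⟨j, (Prod.mk.inj hj).1⟩
        simp only [Matrix.of_apply, if_neg (this _), if_neg ha, zero_mul,
          Finset.sum_const_zero, add_zero, Pi.zero_apply]

/-- If `A` is supported on the edges of an acyclic graph, then `det (1 + A) = 1`. -/
theorem det_one_add_eq_one_of_not_hasDirectedCycle {n : ℕ} {R : Type*} [CommRing R]
    {E : Set (Fin n × Fin n)} (h : ¬ HasDirectedCycle E) (A : Matrix (Fin n) (Fin n) R)
    (hA : ∀ i j, (i, j) ∉ E → A i j = 0) : (1 + A).det = 1 := by
  have hloop (i : Fin n) : A i i = 0 :=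
    hA i i fun hi => h ⟨1, one_pos, fun _ => i, Function.injective_of_subsingleton _, fun _ => hi⟩
  rw [← Matrix.det_transpose, Matrix.det_apply, Finset.sum_eq_single 1]
  · simp [hloop]
  · intro σ _ hσ
    obtain ⟨x, hx⟩ : ∃ x, σ x ≠ x := by
      by_contra! hfix
      exact hσ (Equiv.ext hfix)
    obtain ⟨y, hy, hyE⟩ : ∃ y, σ y ≠ y ∧ (y, σ y) ∉ E := by
      by_contra! hmove
      exact h (HasDirectedCycle.of_perm σ hmove hx)
    rw [Finset.prod_eq_zero (Finset.mem_univ y), smul_zero]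
    simp [hA _ _ hyE, Matrix.one_apply_ne hy.symm]
  · simp

theorem stmt_15 (n : ℕ) (E : Finset (Fin n × Fin n)) :
    (Matrix.det (1 + Matrix.of (fun i j : Fin n =>
        if (i, j) ∈ E then MvPolynomial.X (i, j)
        else (0 : MvPolynomial (Fin n × Fin n) ℚ))) = 1)
      ↔ ¬ HasDirectedCycle (↑E : Set (Fin n × Fin n)) := by
  constructor
  · intro hdet hcyc
    obtain ⟨w, hw, hzero⟩ := hcyc.exists_det_eq_zero
    have heval := congrArg (MvPolynomial.eval w) hdet
    rw [RingHom.map_det, map_add, map_one, map_one] at heval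
    refine one_ne_zero (α := ℚ) (heval.symm.trans (Eq.trans ?_ hzero))
    congr 2
    ext i j
    by_cases hij : (i, j) ∈ E
    · simp [hij]
    · simp [hij, hw (i, j) (by simpa using hij)]
  · intro h
    refine det_one_add_eq_one_of_not_hasDirectedCycle h _ fun i j hij => ?_
    exact if_neg (by simpa using hij)
end

section
/- A single column update can change Ω(nt) entries of the inverse: for all natural numbers n and t with 2 ≤ t ≤ n, there exist invertible n×n matrices T and T' over ℚ such that: T agrees with the identity matrix on all but at most t columns; T' agrees with T on all but exactly one column; and the inverses T⁻¹ and T'⁻¹ differ in at least (n − t)·(t − 1) entries, i.e. the set {(i, j) : T⁻¹ i j ≠ T'⁻¹ i j} has cardinality at least (n − t)·(t − 1). -/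
open Matrix

theorem stmt_18 (n t : ℕ) (h2 : 2 ≤ t) (hn : t ≤ n) :
    ∃ T T' : Matrix (Fin n) (Fin n) ℚ,
      IsUnit T.det ∧ IsUnit T'.det ∧
      (∃ J : Finset (Fin n), J.card ≤ t ∧
        ∀ j ∉ J, ∀ i, T i j = (1 : Matrix (Fin n) (Fin n) ℚ) i j) ∧
      (∃ j₀ : Fin n, (∃ i, T' i j₀ ≠ T i j₀) ∧ ∀ j ≠ j₀, ∀ i, T' i j = T i j) ∧
      (n - t) * (t - 1) ≤
        (Finset.univ.filter (fun p : Fin n × Fin n => T⁻¹ p.1 p.2 ≠ T'⁻¹ p.1 p.2)).card := by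
  let z : Fin n := ⟨0, by omega⟩
  let e : Fin n → ℚ := Pi.single z 1
  let w : Fin n → ℚ := fun j => if 0 < j.val ∧ j.val < t then 1 else 0
  let u : Fin n → ℚ := fun i => if i.val = 0 ∨ t ≤ i.val then 1 else 0
  have hwe : w ⬝ᵥ e = 0 := by simp [e, w, z]
  have heu : e ⬝ᵥ u = 1 := by simp [e, u, z]
  have hee : e ⬝ᵥ e = 1 := by simp [e]
  have hwu : w ⬝ᵥ u = 0 := by
    refine Finset.sum_eq_zero fun i _ => ?_
    by_cases h : 0 < i.val ∧ i.val < t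
    · have : ¬ (i.val = 0 ∨ t ≤ i.val) := by omega
      simp only [u, if_neg this, mul_zero]
    · simp only [w, if_neg h, zero_mul]
  have hT : (1 - vecMulVec e w) * (1 + vecMulVec e w) = 1 := by
    simp [sub_mul, mul_add, vecMulVec_mul_vecMulVec, hwe]
  have hT' : (1 - vecMulVec e w + vecMulVec u e) *
      (1 + vecMulVec e w - (1 / 2 : ℚ) • (vecMulVec u e + vecMulVec u w)) = 1 := by
    simp only [sub_mul, add_mul, mul_add, mul_sub, mul_smul_comm, vecMulVec_mul_vecMulVec, hwe,
      heu, hee, hwu, one_mul, mul_one, zero_smul, one_smul, vecMulVec_zero]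
    module
  refine ⟨1 - vecMulVec e w, 1 - vecMulVec e w + vecMulVec u e, isUnit_det_of_right_inverse hT,
    isUnit_det_of_right_inverse hT', ⟨Finset.univ.image (Fin.castLE hn), ?_, ?_⟩,
    ⟨z, ⟨z, ?_⟩, ?_⟩, ?_⟩
  · exact Finset.card_image_le.trans (by simp)
  · intro j hj i
    have hjt : ¬ (0 < j.val ∧ j.val < t) := fun h =>
      hj (Finset.mem_image.2 ⟨⟨j, h.2⟩, Finset.mem_univ _, rfl⟩)
    simp only [Matrix.sub_apply, vecMulVec_apply, w, if_neg hjt, mul_zero, sub_zero]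
  · simp [vecMulVec_apply, e, u, z]
  · intro j hj i
    simp [vecMulVec_apply, e, hj]
  · rw [inv_eq_right_inv hT, inv_eq_right_inv hT']
    let f : Fin (n - t) × Fin (t - 1) → Fin n × Fin n := fun p =>
      (⟨t + p.1, by omega⟩, ⟨p.2 + 1, by omega⟩)
    have hf : Function.Injective f := by
      rintro ⟨a, b⟩ ⟨c, d⟩ h
      simpa [f, Fin.ext_iff] using h
    calc (n - t) * (t - 1) = (Finset.univ : Finset (Fin (n - t) × Fin (t - 1))).card := by simp
      _ ≤ _ := Finset.card_le_card_of_injOn f (fun p _ => ?_) hf.injOn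
    have hp : p.2.val + 1 < t := by omega
    refine Finset.mem_filter.2 ⟨Finset.mem_univ _, fun h => ?_⟩
    simp [f, vecMulVec_apply, e, u, w, z, hp] at h
    linarith
end
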